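/- Let Λ := ℤ₃[X]/(X³−1), where ℤ₃ is the ring of 3-adic integers; Λ is a local ring, and let π : Λ → F₃ be the ring homomorphism induced by reduction modulo 3 on ℤ₃ and by sending the class of X to 1. Then there exists a group homomorphism ρ₀ : SL_2(F₃) → GL_2(Λ) with π(ρ₀(M)(a,b)) = M(a,b) for all M and a,b, having the following universal property: for every Artinian local commutative ring S with residue field F₃ (with reduction π_S : S → F₃) and every group homomorphism ρ : SL_2(F₃) → GL_2(S) satisfying π_S(ρ(M)(a,b)) = M(a,b) for all M, a, b, there exist a unique local ring homomorphism f : Λ → S with π_S ∘ f = π and a matrix X ∈ GL_2(S) with X ≡ I mod m_S such that ρ(M) = X · f(ρ₀(M)) · X⁻¹ for all M ∈ SL_2(F₃), where f is applied entrywise. -/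

import Mathlib

open Matrix IsLocalRing

/-- The ring `Λ = ℤ₃[X]/(X³ − 1)`. -/
noncomputable abbrev Z3X3 : Type :=
  AdjoinRoot (Polynomial.X ^ 3 - 1 : Polynomial ℤ_[3])

/-- The reduction `π : ℤ₃[X]/(X³ − 1) → F₃`, induced by reduction mod 3 on `ℤ₃` and
sending the class of `X` to `1`. -/
noncomputable def Z3X3.toZMod : Z3X3 →+* ZMod 3 :=
  AdjoinRoot.lift PadicInt.toZMod (1 : ZMod 3) (by
    simp [Polynomial.eval₂_sub, Polynomial.eval₂_pow])


namespace Z3Aux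

abbrev F := ZMod 3

/-- quaternion coordinates of a matrix over `F₃`, relative to `1, I, J, IJ` -/
def co (p q r s : F) : Fin 4 → F := ![-(p+s), q-r, q+r-s+p, q+r+s-p]

def chi (p q r s : F) : F := (-(p+s)) * (q-r) * (q+r-s+p) * (q+r+s-p)

def sg (c : F) : ℤ := if c = 0 then 0 else if c = 1 then 1 else -1

/-- doubled integral coordinates of the Hurwitz unit lifting the matrix -/
def li (p q r s : F) (k : Fin 4) : ℤ :=
  if chi p q r s = 0 then 2 * sg (co p q r s k) else - sg (co p q r s k)

lemma chi_mul : ∀ p q r s : F, p*s-q*r=1 → ∀ p' q' r' s' : F, p'*s'-q'*r'=1 →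
    chi (p*p'+q*r') (p*q'+q*s') (r*p'+s*r') (r*q'+s*s') = chi p q r s + chi p' q' r' s' := by
  decide +kernel

lemma li_mul : ∀ p q r s : F, p*s-q*r=1 → ∀ p' q' r' s' : F, p'*s'-q'*r'=1 →
    2 * li (p*p'+q*r') (p*q'+q*s') (r*p'+s*r') (r*q'+s*s') 0 =
      li p q r s 0 * li p' q' r' s' 0 - li p q r s 1 * li p' q' r' s' 1
      - li p q r s 2 * li p' q' r' s' 2 - li p q r s 3 * li p' q' r' s' 3 ∧
    2 * li (p*p'+q*r') (p*q'+q*s') (r*p'+s*r') (r*q'+s*s') 1 =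
      li p q r s 0 * li p' q' r' s' 1 + li p q r s 1 * li p' q' r' s' 0
      + li p q r s 2 * li p' q' r' s' 3 - li p q r s 3 * li p' q' r' s' 2 ∧
    2 * li (p*p'+q*r') (p*q'+q*s') (r*p'+s*r') (r*q'+s*s') 2 =
      li p q r s 0 * li p' q' r' s' 2 + li p q r s 2 * li p' q' r' s' 0
      + li p q r s 3 * li p' q' r' s' 1 - li p q r s 1 * li p' q' r' s' 3 ∧
    2 * li (p*p'+q*r') (p*q'+q*s') (r*p'+s*r') (r*q'+s*s') 3 =
      li p q r s 0 * li p' q' r' s' 3 + li p q r s 3 * li p' q' r' s' 0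
      + li p q r s 1 * li p' q' r' s' 2 - li p q r s 2 * li p' q' r' s' 1 := by
  decide +kernel

lemma li_red : ∀ p q r s : F, p*s-q*r=1 → 
    (2 * ((li p q r s 0 : F) + li p q r s 2 - li p q r s 3) = p ∧
     2 * (-(li p q r s 1 : F) + li p q r s 2 + li p q r s 3) = q ∧
     2 * ((li p q r s 1 : F) + li p q r s 2 + li p q r s 3) = r ∧
     2 * ((li p q r s 0 : F) - li p q r s 2 + li p q r s 3) = s) := by
  decide +kernel

abbrev SL := SpecialLinearGroup (Fin 2) F

lemma sl_det (M : SL) : M.1 0 0 * M.1 1 1 - M.1 0 1 * M.1 1 0 = 1 := by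
  have := M.2; rwa [Matrix.det_fin_two] at this

def chiM (M : SL) : F := chi (M.1 0 0) (M.1 0 1) (M.1 1 0) (M.1 1 1)
def liM (M : SL) (k : Fin 4) : ℤ := li (M.1 0 0) (M.1 0 1) (M.1 1 0) (M.1 1 1) k

lemma chiM_mul (M N : SL) : chiM (M * N) = chiM M + chiM N := by
  have := chi_mul _ _ _ _ (sl_det M) _ _ _ _ (sl_det N)
  simpa [chiM, Matrix.mul_apply, Fin.sum_univ_two] using this

def chiHom : SL →* Multiplicative F where
  toFun M := Multiplicative.ofAdd (chiM M)
  map_one' := by decide +kernel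
  map_mul' M N := by rw [chiM_mul]; rfl

def mat {A : Type*} [CommRing A] (β h X : A) (M : SL) : Matrix (Fin 2) (Fin 2) A :=
  (X ^ (chiM M).val * h) • !![(liM M 0 : A) + liM M 2 - β * liM M 3, -(liM M 1 : A) + β * liM M 2 + liM M 3;
     (liM M 1 : A) + β * liM M 2 + liM M 3, (liM M 0 : A) - liM M 2 + β * liM M 3]

lemma pow_val {A : Type*} [CommRing A] (X : A) (hX : X^3 = 1) (a b : F) :
    X ^ (a + b).val = X ^ a.val * X ^ b.val := by
  rw [ZMod.val_add, ← pow_add]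
  conv_rhs => rw [← Nat.mod_add_div (a.val + b.val) 3, pow_add, pow_mul, hX, one_pow, mul_one]

lemma mat_mul {A : Type*} [CommRing A] (β h X : A) (hβ : β^2 = -2) (hh : 2 * h = 1) (hX : X^3 = 1)
    (M N : SL) : mat β h X (M * N) = mat β h X M * mat β h X N := by
  have h0 := li_mul _ _ _ _ (sl_det M) _ _ _ _ (sl_det N)
  have h1 : ∀ k, liM (M * N) k = li (M.1 0 0 * N.1 0 0 + M.1 0 1 * N.1 1 0)
      (M.1 0 0 * N.1 0 1 + M.1 0 1 * N.1 1 1) (M.1 1 0 * N.1 0 0 + M.1 1 1 * N.1 1 0)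
      (M.1 1 0 * N.1 0 1 + M.1 1 1 * N.1 1 1) k := by
    intro k; simp [liM, Matrix.mul_apply, Fin.sum_univ_two]
  simp only [← h1] at h0
  obtain ⟨e0, e1, e2, e3⟩ := h0
  change _ = liM M 0 * liM N 0 - liM M 1 * liM N 1 - liM M 2 * liM N 2 - liM M 3 * liM N 3 at e0
  change _ = liM M 0 * liM N 1 + liM M 1 * liM N 0 + liM M 2 * liM N 3 - liM M 3 * liM N 2 at e1
  change _ = liM M 0 * liM N 2 + liM M 2 * liM N 0 + liM M 3 * liM N 1 - liM M 1 * liM N 3 at e2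
  change _ = liM M 0 * liM N 3 + liM M 3 * liM N 0 + liM M 1 * liM N 2 - liM M 2 * liM N 1 at e3
  have c0 := congrArg (Int.cast : ℤ → A) e0
  have c1 := congrArg (Int.cast : ℤ → A) e1
  have c2 := congrArg (Int.cast : ℤ → A) e2
  have c3 := congrArg (Int.cast : ℤ → A) e3
  push_cast at c0 c1 c2 c3
  have key : ∀ u v : A, 2 * u = v → h * u = h * h * v := by
    intro u v e; rw [← e]; linear_combination (-h * u) * hh
  unfold mat
  rw [chiM_mul, pow_val X hX, Matrix.smul_mul, Matrix.mul_smul, smul_smul]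
  generalize X ^ (chiM M).val = x
  generalize X ^ (chiM N).val = y
  ext i j
  fin_cases i <;> fin_cases j <;> simp [Matrix.mul_apply, Fin.sum_univ_two]
  all_goals rw [show x * h * (y * h) = (x * y) * (h * h) by ring, mul_assoc (x*y), mul_assoc (x*y)]
  all_goals congr 1
  all_goals apply key
  · linear_combination c0 + c2 - β * c3 - ((liM M 2 : A) * liM N 2 + liM M 3 * liM N 3) * hβ
  · linear_combination -c1 + β * c2 + c3 - ((liM M 2 : A) * liM N 3 - liM M 3 * liM N 2) * hβ
  · linear_combination c1 + β * c2 + c3 - ((liM M 3 : A) * liM N 2 - liM M 2 * liM N 3) * hβ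
  · linear_combination c0 - c2 + β * c3 - ((liM M 2 : A) * liM N 2 + liM M 3 * liM N 3) * hβ

lemma mat_one {A : Type*} [CommRing A] (β h X : A) (hh : 2 * h = 1) : mat β h X 1 = 1 := by
  have h0 : chiM 1 = 0 := by decide +kernel
  have l0 : liM 1 0 = 2 := by decide +kernel
  have l1 : liM 1 1 = 0 := by decide +kernel
  have l2 : liM 1 2 = 0 := by decide +kernel
  have l3 : liM 1 3 = 0 := by decide +kernel
  unfold mat
  rw [h0, l0, l1, l2, l3]
  ext i j
  fin_cases i <;> fin_cases j <;> simp [mul_comm h, hh]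

def rep {A : Type*} [CommRing A] (β h X : A) (hβ : β^2 = -2) (hh : 2 * h = 1) (hX : X^3 = 1) :
    SL →* GL (Fin 2) A :=
  MonoidHom.toHomUnits
    { toFun := mat β h X
      map_one' := mat_one β h X hh
      map_mul' := mat_mul β h X hβ hh hX }

lemma rep_coe {A : Type*} [CommRing A] (β h X : A) (hβ : β^2 = -2) (hh : 2 * h = 1) (hX : X^3 = 1)
    (M : SL) : (rep β h X hβ hh hX M : Matrix (Fin 2) (Fin 2) A) = mat β h X M := rfl

/-- The standard unipotent element. -/
def T : SL := ⟨!![1, 1; 0, 1], by decide +kernel⟩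
def I : SL := ⟨!![0, -1; 1, 0], by decide +kernel⟩
def J : SL := ⟨!![1, 1; 1, -1], by decide +kernel⟩

lemma chi_T : chiM T = 1 := by decide +kernel

lemma mat_det_T {A : Type*} [CommRing A] (β h X : A) (hβ : β^2 = -2) (hh : 2 * h = 1) :
    (mat β h X T).det = X ^ 2 := by
  have l0 : liM T 0 = -1 := by decide +kernel
  have l1 : liM T 1 = -1 := by decide +kernel
  have l2 : liM T 2 = -1 := by decide +kernel
  have l3 : liM T 3 = -1 := by decide +kernel
  have e : (1 : F).val = 1 := by decide +kernel
  unfold mat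
  rw [chi_T, l0, l1, l2, l3, Matrix.det_smul, Matrix.det_fin_two, e]
  simp
  linear_combination (-2 * X^2*h^2) * hβ + X^2*(2*h+1) * hh

lemma mat_red {A : Type*} [CommRing A] (β h X : A) (π : A →+* F) (hβ : π β = 1) (hh : 2 * h = 1)
    (hX : π X = 1) (M : SL) (a b : Fin 2) : π (mat β h X M a b) = M.1 a b := by
  have hh' : π h = 2 := by
    have := congrArg π hh
    rw [map_mul, map_ofNat, map_one] at this
    revert this
    generalize π h = y
    revert y
    decide +kernel
  obtain ⟨r0, r1, r2, r3⟩ := li_red _ _ _ _ (sl_det M)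
  change 2 * ((liM M 0 : F) + liM M 2 - liM M 3) = _ at r0
  change 2 * (-(liM M 1 : F) + liM M 2 + liM M 3) = _ at r1
  change 2 * ((liM M 1 : F) + liM M 2 + liM M 3) = _ at r2
  change 2 * ((liM M 0 : F) - liM M 2 + liM M 3) = _ at r3
  fin_cases a <;> fin_cases b <;>
    simp [mat, hβ, hX, hh', r0, r1, r2, r3]

lemma padic_hom_eq {R : Type*} [CommRing R] (n : ℕ) (h3 : (3 : R)^n = 0) (φ ψ : ℤ_[3] →+* R) :
    φ = ψ := by
  ext z
  have hz := PadicInt.appr_spec n z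
  rw [Ideal.mem_span_singleton] at hz
  obtain ⟨c, hc⟩ := hz
  have key : ∀ θ : ℤ_[3] →+* R, θ z = ((z.appr n : ℕ) : R) := by
    intro θ
    have := congrArg θ hc
    simp only [map_sub, map_mul, map_pow, map_natCast] at this
    have e3 : (((3 : ℕ) : R))^n = 0 := by exact_mod_cast h3
    rw [e3, zero_mul, sub_eq_zero] at this
    exact this
  rw [key φ, key ψ]

lemma hom_eq {R : Type*} [CommRing R] (n : ℕ) (h3 : (3 : R)^n = 0) (φ ψ : Z3X3 →+* R)
    (h : φ (AdjoinRoot.root _) = ψ (AdjoinRoot.root _)) : φ = ψ := 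
  AdjoinRoot.ringHom_ext (padic_hom_eq n h3 _ _) h

lemma root_cube : (AdjoinRoot.root (Polynomial.X ^ 3 - 1 : Polynomial ℤ_[3]))^3 = 1 := by
  have := AdjoinRoot.eval₂_root (Polynomial.X ^ 3 - 1 : Polynomial ℤ_[3])
  simpa [Polynomial.eval₂_sub, sub_eq_zero] using this

lemma toZMod_root : Z3X3.toZMod (AdjoinRoot.root _) = 1 := by
  simp [Z3X3.toZMod]

lemma isUnit_of_toZMod (a : Z3X3) (ha : Z3X3.toZMod a ≠ 0) : IsUnit a := by
  by_contra hu
  obtain ⟨m, hm, ham⟩ := exists_max_ideal_of_mem_nonunits hu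
  have hmon : (Polynomial.X ^ 3 - 1 : Polynomial ℤ_[3]).Monic :=
    Polynomial.monic_X_pow_sub_C 1 (by norm_num)
  haveI : Module.Finite ℤ_[3] Z3X3 := hmon.finite_adjoinRoot
  haveI : Algebra.IsIntegral ℤ_[3] Z3X3 := inferInstance
  have hmax : (m.comap (algebraMap ℤ_[3] Z3X3)).IsMaximal :=
    Ideal.isMaximal_comap_of_isIntegral_of_isMaximal m
  have h3 : (3 : ℤ_[3]) ∈ m.comap (algebraMap ℤ_[3] Z3X3) := by
    rw [IsLocalRing.eq_maximalIdeal hmax, PadicInt.maximalIdeal_eq_span_p]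
    exact Ideal.mem_span_singleton_self _
  rw [Ideal.mem_comap, map_ofNat] at h3
  letI := Ideal.Quotient.field m
  have q3 : (3 : Z3X3 ⧸ m) = 0 := by
    have := Ideal.Quotient.eq_zero_iff_mem.mpr h3
    rwa [map_ofNat] at this
  haveI : CharP (Z3X3 ⧸ m) 3 := (CharP.charP_iff_prime_eq_zero Nat.prime_three).mpr (by exact_mod_cast q3)
  have hq : Ideal.Quotient.mk m = (ZMod.castHom (dvd_refl 3) (Z3X3 ⧸ m)).comp Z3X3.toZMod := by
    apply hom_eq 1 (by simpa using q3)
    rw [RingHom.comp_apply, toZMod_root, map_one]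
    set x := Ideal.Quotient.mk m (AdjoinRoot.root _) with hx
    have hx3 : x^3 = 1 := by rw [hx, ← map_pow, root_cube, map_one]
    have : (x - 1)^3 = 0 := by linear_combination hx3 + (-x^2 + x) * q3
    exact sub_eq_zero.mp (pow_eq_zero_iff (by norm_num) |>.mp this)
  have := congrArg (fun φ => φ a) hq
  simp only [RingHom.comp_apply] at this
  rw [Ideal.Quotient.eq_zero_iff_mem.mpr ham] at this
  exact ha ((map_eq_zero _).mp this.symm)

lemma exists_sqrt : ∃ z : ℤ_[3], z^2 = -2 ∧ PadicInt.toZMod z = 1 := by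
  have n2 : ‖(2 : ℤ_[3])‖ = 1 := by
    have := (PadicInt.isUnit_iff (p := 3) (z := 2)).mp (by
      have : ¬ ‖((2 : ℤ) : ℤ_[3])‖ < 1 := by
        rw [PadicInt.norm_int_lt_one_iff_dvd]; norm_num
      rw [PadicInt.isUnit_iff]
      exact le_antisymm (PadicInt.norm_le_one _) (not_lt.mp (by exact_mod_cast this)))
    exact this
  have n3 : ‖(3 : ℤ_[3])‖ < 1 := by
    have : ‖((3 : ℤ) : ℤ_[3])‖ < 1 := by
      rw [PadicInt.norm_int_lt_one_iff_dvd]; norm_num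
    exact_mod_cast this
  obtain ⟨z, h1, h2, -⟩ := hensels_lemma (p := 3) (F := (Polynomial.X^2 + 2 : Polynomial ℤ_[3])) (a := (1 : ℤ_[3])) (by
    have e : (1 : ℤ_[3]) + 2 = 3 := by norm_num
    simp [Polynomial.aeval_def, e, one_add_one_eq_two, n2, n3])
  refine ⟨z, ?_, ?_⟩
  · simp at h1; linear_combination h1
  · simp [one_add_one_eq_two, n2] at h2
    have : z - 1 ∈ RingHom.ker (PadicInt.toZMod (p := 3)) := by
      rw [PadicInt.ker_toZMod, IsLocalRing.mem_maximalIdeal, PadicInt.mem_nonunits]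
      exact h2
    rw [RingHom.mem_ker, map_sub, map_one, sub_eq_zero] at this
    exact this

lemma dec_M (M : SL) : chiM (T ^ (-(chiM M)).val * M) = 0 := by
  have h : ∀ n : ℕ, chiM (T ^ n) = n := by
    intro n
    induction n with
    | zero => simp; decide +kernel
    | succ n ih => rw [pow_succ, chiM_mul, ih, chi_T]; push_cast; ring
  rw [chiM_mul, h, ZMod.natCast_zmod_val, neg_add_cancel]

def Q : Subgroup SL := chiHom.ker

lemma mem_Q (M : SL) : M ∈ Q ↔ chiM M = 0 := by
  rw [Q, MonoidHom.mem_ker]; rfl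

instance : DecidablePred (· ∈ Q) := fun M => decidable_of_iff _ (mem_Q M).symm

lemma card_Q : ((Finset.univ.filter (fun M : SL => chiM M = 0)).card : F) = 2 := by
  have : (Finset.univ.filter (fun M : SL => chiM M = 0)).card = 8 := by decide +kernel
  rw [this]; decide +kernel

lemma rigid {S : Type*} [CommRing S] [IsLocalRing S] (π : S →+* F)
    (hk : RingHom.ker π = maximalIdeal S) (ρ σ : SL →* GL (Fin 2) S)
    (hρ : ∀ (M : SL) (a b : Fin 2), π ((ρ M : Matrix (Fin 2) (Fin 2) S) a b) = M.1 a b)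
    (hσ : ∀ (M : SL) (a b : Fin 2), π ((σ M : Matrix (Fin 2) (Fin 2) S) a b) = M.1 a b)
    (hdet : (ρ T : Matrix (Fin 2) (Fin 2) S).det = (σ T : Matrix (Fin 2) (Fin 2) S).det) :
    ∃ X : GL (Fin 2) S, (∀ a b, (X : Matrix (Fin 2) (Fin 2) S) a b -
                (1 : Matrix (Fin 2) (Fin 2) S) a b ∈ maximalIdeal S) ∧
      ∀ M, ρ M = X * σ M * X⁻¹ := by
  have unit_of : ∀ s : S, π s ≠ 0 → IsUnit s := by
    intro s hs
    by_contra hu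
    have : s ∈ maximalIdeal S := (IsLocalRing.mem_maximalIdeal s).mpr hu
    rw [← hk] at this
    exact hs this
  have hρ' : ∀ M : SL, (ρ M : Matrix (Fin 2) (Fin 2) S).map π = M.1 := fun M => by
    ext a b; exact hρ M a b
  have hσ' : ∀ M : SL, (σ M : Matrix (Fin 2) (Fin 2) S).map π = M.1 := fun M => by
    ext a b; exact hσ M a b
  -- averaging
  let X0 : Matrix (Fin 2) (Fin 2) S :=
    -∑ q ∈ Finset.univ.filter (fun M : SL => chiM M = 0), ((ρ q : Matrix (Fin 2) (Fin 2) S) * (σ q⁻¹ : Matrix (Fin 2) (Fin 2) S))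
  have hX0 : π.mapMatrix X0 = 1 := by
    simp only [X0, map_neg, map_sum, map_mul, RingHom.mapMatrix_apply, hρ', hσ']
    have : ∀ q : SL, q.1 * (q⁻¹).1 = 1 := fun q => by
      have := congrArg Subtype.val (mul_inv_cancel q)
      rwa [Matrix.SpecialLinearGroup.coe_mul] at this
    rw [Finset.sum_congr rfl (fun q _ => this q), Finset.sum_const, ← Nat.cast_smul_eq_nsmul F, card_Q]
    decide +kernel
  have hcomm : ∀ g : SL, chiM g = 0 → (ρ g : Matrix (Fin 2) (Fin 2) S) * X0 = X0 * (σ g : Matrix (Fin 2) (Fin 2) S) := by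
    intro g hg
    simp only [X0, mul_neg, neg_mul, Finset.mul_sum, Finset.sum_mul]
    congr 1
    refine Finset.sum_bij' (fun q _ => g * q) (fun q _ => g⁻¹ * q) ?_ ?_ ?_ ?_ ?_
    · intro q hq
      simp only [Finset.mem_filter, Finset.mem_univ, true_and] at hq ⊢
      rw [← mem_Q] at *
      exact Q.mul_mem hg hq
    · intro q hq
      simp only [Finset.mem_filter, Finset.mem_univ, true_and] at hq ⊢
      rw [← mem_Q] at *
      exact Q.mul_mem (Q.inv_mem hg) hq
    · intro q _; simp
    · intro q _; simp
    · intro q _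
      rw [map_mul, Units.val_mul, mul_assoc, mul_assoc]
      rw [← Units.val_mul (σ _), ← map_mul, _root_.mul_inv_rev, mul_assoc, inv_mul_cancel, mul_one]
  have hXu : IsUnit X0 := by
    rw [Matrix.isUnit_iff_isUnit_det]
    apply unit_of
    rw [RingHom.map_det, hX0, Matrix.det_one]
    exact one_ne_zero
  obtain ⟨X, hX⟩ := hXu
  have hQ : ∀ g : SL, chiM g = 0 → ρ g = X * σ g * X⁻¹ := by
    intro g hg
    rw [eq_mul_inv_iff_mul_eq]
    ext1
    rw [Units.val_mul, Units.val_mul, hX]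
    exact hcomm g hg
  refine ⟨X, ?_, ?_⟩
  · intro a b
    rw [← hk, RingHom.mem_ker, hX, map_sub, sub_eq_zero]
    have := congrFun (congrFun hX0 a) b
    rw [RingHom.mapMatrix_apply, Matrix.map_apply] at this
    rw [this]
    by_cases h : a = b <;> simp [Matrix.one_apply, h]
  -- the second representation conjugated
  let τ : SL →* GL (Fin 2) S := (MulAut.conj X).toMonoidHom.comp σ
  have hτ : ∀ M, τ M = X * σ M * X⁻¹ := fun M => rfl
  simp only [← hτ] at hQ ⊢
  have hτπ : ∀ M : SL, π.mapMatrix (τ M : Matrix (Fin 2) (Fin 2) S) = M.1 := by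
    intro M
    have e : (τ M : Matrix (Fin 2) (Fin 2) S) * X0 = X0 * (σ M : Matrix (Fin 2) (Fin 2) S) := by
      rw [← hX, ← Units.val_mul, ← Units.val_mul, hτ, inv_mul_cancel_right]
    have := congrArg π.mapMatrix e
    rw [map_mul, map_mul, hX0, mul_one, one_mul] at this
    rw [this]
    exact hσ' M
  obtain ⟨C, hCd⟩ : ∃ C : GL (Fin 2) S, C = (ρ T)⁻¹ * τ T := ⟨_, rfl⟩
  have hC : ∀ g : SL, chiM g = 0 → C * ρ g = ρ g * C := by
    intro g hg
    have hg' : chiM (T * g * T⁻¹) = 0 := by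
      rw [← mem_Q] at *
      exact (inferInstance : chiHom.ker.Normal).conj_mem g hg T
    have e1 := hQ g hg
    have e2 := hQ _ hg'
    simp only [map_mul, map_inv] at e2
    calc C * ρ g = (ρ T)⁻¹ * (τ T * τ g * (τ T)⁻¹) * τ T := by rw [e1]; rw [hCd]; group
      _ = ρ g * C := by rw [← e2]; rw [hCd]; group
  have hCπ : π.mapMatrix (C : Matrix (Fin 2) (Fin 2) S) = 1 := by
    have e : (ρ T : Matrix (Fin 2) (Fin 2) S) * C = τ T := by
      rw [← Units.val_mul]; simp [hCd]
    have := congrArg π.mapMatrix e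
    rw [map_mul, hτπ, RingHom.mapMatrix_apply, hρ'] at this
    have h2 := congrArg (fun N => (T⁻¹).1 * N) this
    simp only [← mul_assoc] at h2
    have h3 : (T⁻¹).1 * T.1 = (1 : Matrix (Fin 2) (Fin 2) F) := by decide +kernel
    rwa [h3, one_mul] at h2
  have hCdet : (C : Matrix (Fin 2) (Fin 2) S).det = 1 := by
    have e : (ρ T : Matrix (Fin 2) (Fin 2) S) * C * X = X * σ T := by
      rw [← Units.val_mul, ← Units.val_mul, ← Units.val_mul]; simp [hCd, hτ]
    have := congrArg Matrix.det e
    rw [Matrix.det_mul, Matrix.det_mul, Matrix.det_mul, ← hdet] at this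
    have u1 : IsUnit (X : Matrix (Fin 2) (Fin 2) S).det := (Matrix.isUnit_iff_isUnit_det _).mp X.isUnit
    have u2 : IsUnit (ρ T : Matrix (Fin 2) (Fin 2) S).det := (Matrix.isUnit_iff_isUnit_det _).mp (ρ T).isUnit
    apply (u2.mul u1).mul_left_cancel
    linear_combination this
  have hC1 : C = 1 := by
    have cI := congrArg Units.val (hC I (by decide +kernel))
    have cJ := congrArg Units.val (hC J (by decide +kernel))
    rw [Units.val_mul, Units.val_mul] at cI cJ
    have I00 := hρ I 0 0
    have I01 := hρ I 0 1
    have I10 := hρ I 1 0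
    have J01 := hρ J 0 1
    have J10 := hρ J 1 0
    have C00 : π ((C : Matrix (Fin 2) (Fin 2) S) 0 0) = 1 := by
      have := congrFun (congrFun hCπ 0) 0
      simpa using this
    have x00 := congrFun (congrFun cI 0) 0
    have x01 := congrFun (congrFun cI 0) 1
    have y00 := congrFun (congrFun cJ 0) 0
    simp only [Matrix.mul_apply, Fin.sum_univ_two] at x00 x01 y00
    rw [Matrix.det_fin_two] at hCdet
    have ub : IsUnit ((ρ I : Matrix (Fin 2) (Fin 2) S) 0 1) := unit_of _ (by rw [I01]; decide +kernel)
    have ud : IsUnit ((ρ J : Matrix (Fin 2) (Fin 2) S) 1 0 * (ρ I : Matrix (Fin 2) (Fin 2) S) 0 1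
        - (ρ J : Matrix (Fin 2) (Fin 2) S) 0 1 * (ρ I : Matrix (Fin 2) (Fin 2) S) 1 0) :=
      unit_of _ (by rw [map_sub, map_mul, map_mul, I01, I10, J01, J10]; decide +kernel)
    have q0 : (C : Matrix (Fin 2) (Fin 2) S) 0 1 = 0 := by
      apply ud.mul_left_cancel
      linear_combination (ρ I : Matrix (Fin 2) (Fin 2) S) 0 1 * y00 - (ρ J : Matrix (Fin 2) (Fin 2) S) 0 1 * x00
    have r0 : (C : Matrix (Fin 2) (Fin 2) S) 1 0 = 0 := by
      apply ub.mul_left_cancel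
      linear_combination -x00 + (ρ I : Matrix (Fin 2) (Fin 2) S) 1 0 * q0
    have u0 : (C : Matrix (Fin 2) (Fin 2) S) 0 0 = (C : Matrix (Fin 2) (Fin 2) S) 1 1 := by
      apply ub.mul_left_cancel
      rw [q0] at x01
      linear_combination x01
    have p1 : (C : Matrix (Fin 2) (Fin 2) S) 0 0 = 1 := by
      have up : IsUnit ((C : Matrix (Fin 2) (Fin 2) S) 0 0 + 1) :=
        unit_of _ (by rw [map_add, C00, map_one]; decide +kernel)
      apply up.mul_left_cancel
      rw [← u0, q0] at hCdet
      linear_combination hCdet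
    ext a b
    fin_cases a <;> fin_cases b <;> simp [q0, r0, p1, ← u0]
  have hT : ρ T = τ T := by
    have : (ρ T)⁻¹ * τ T = 1 := hCd ▸ hC1
    exact inv_mul_eq_one.mp this
  intro M
  have h1 := hQ _ (dec_M M)
  rw [map_mul, map_mul, map_pow, map_pow, hT] at h1
  exact mul_left_cancel h1

end Z3Aux

/-- `Λ = ℤ₃[X]/(X³ − 1)` is the universal deformation ring of the natural
representation of `SL_2(F₃)`: there is a lift `ρ₀` of the inclusion
`SL_2(F₃) ⊆ GL_2(F₃)` to `Λ` such that every lift `ρ` to an Artinian local ring `S`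
with residue field `F₃` is strictly equivalent to `f ∘ ρ₀` for a unique local ring
homomorphism `f : Λ → S` compatible with the reductions. -/
theorem Z3X3_is_universal_deformation_ring_of_sl2_F3 :
    ∃ ρ₀ : SpecialLinearGroup (Fin 2) (ZMod 3) →* GL (Fin 2) Z3X3,
      (∀ (M : SpecialLinearGroup (Fin 2) (ZMod 3)) (a b : Fin 2),
        Z3X3.toZMod ((ρ₀ M : Matrix (Fin 2) (Fin 2) Z3X3) a b) =
          (M : Matrix (Fin 2) (Fin 2) (ZMod 3)) a b) ∧
      ∀ (S : Type) (_ : CommRing S) (_ : IsLocalRing S) (_ : IsArtinianRing S)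
        (πS : S →+* ZMod 3), Function.Surjective πS → RingHom.ker πS = maximalIdeal S →
        ∀ ρ : SpecialLinearGroup (Fin 2) (ZMod 3) →* GL (Fin 2) S,
          (∀ (M : SpecialLinearGroup (Fin 2) (ZMod 3)) (a b : Fin 2),
            πS ((ρ M : Matrix (Fin 2) (Fin 2) S) a b) =
              (M : Matrix (Fin 2) (Fin 2) (ZMod 3)) a b) →
          ∃! f : Z3X3 →+* S,
            IsLocalHom f ∧
            (∀ x : Z3X3, πS (f x) = Z3X3.toZMod x) ∧
            ∃ X : GL (Fin 2) S,
              (∀ a b, (X : Matrix (Fin 2) (Fin 2) S) a b -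
                (1 : Matrix (Fin 2) (Fin 2) S) a b ∈ maximalIdeal S) ∧
              ∀ M : SpecialLinearGroup (Fin 2) (ZMod 3),
                (ρ M : Matrix (Fin 2) (Fin 2) S) =
                  (X : Matrix (Fin 2) (Fin 2) S) *
                    (ρ₀ M : Matrix (Fin 2) (Fin 2) Z3X3).map f *
                    ((X⁻¹ : GL (Fin 2) S) : Matrix (Fin 2) (Fin 2) S) := by
  obtain ⟨b, hb2, hb1⟩ := Z3Aux.exists_sqrt
  have hu2 : IsUnit (2 : Z3X3) := Z3Aux.isUnit_of_toZMod 2 (by rw [map_ofNat]; decide +kernel)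
  obtain ⟨h, hh⟩ := hu2.exists_right_inv
  let β : Z3X3 := AdjoinRoot.of _ b
  have hβ : β ^ 2 = -2 := by
    simp only [β]; rw [← map_pow, hb2, map_neg, map_ofNat]
  have hβ1 : Z3X3.toZMod β = 1 := by
    simp only [β, Z3X3.toZMod]; rw [AdjoinRoot.lift_of, hb1]
  let x : Z3X3 := AdjoinRoot.root _
  have hx3 : x ^ 3 = 1 := Z3Aux.root_cube
  have hx1 : Z3X3.toZMod x = 1 := Z3Aux.toZMod_root
  let ρ₀ := Z3Aux.rep β h x hβ hh hx3
  have hρ₀ : ∀ (M : SpecialLinearGroup (Fin 2) (ZMod 3)) (a b : Fin 2),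
        Z3X3.toZMod ((ρ₀ M : Matrix (Fin 2) (Fin 2) Z3X3) a b) =
          (M : Matrix (Fin 2) (Fin 2) (ZMod 3)) a b :=
    fun M a b => Z3Aux.mat_red β h x _ hβ1 hh hx1 M a b
  have hdet₀ : (ρ₀ Z3Aux.T : Matrix (Fin 2) (Fin 2) Z3X3).det = x ^ 2 :=
    Z3Aux.mat_det_T β h x hβ hh
  refine ⟨ρ₀, hρ₀, ?_⟩
  intro S _ _ _ πS _ hker ρ hρ
  have h3 : (3 : S) ∈ maximalIdeal S := by
    rw [← hker, RingHom.mem_ker, map_ofNat]; decide +kernel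
  obtain ⟨n, hn⟩ : ∃ n : ℕ, (3 : S) ^ n = 0 := by
    have hnil := IsArtinianRing.isNilpotent_jacobson_bot (R := S)
    rw [IsLocalRing.jacobson_eq_maximalIdeal _ bot_ne_top] at hnil
    obtain ⟨n, hn⟩ := hnil
    refine ⟨n, ?_⟩
    have := Ideal.pow_mem_pow h3 n
    rw [hn] at this
    exact this
  let d : S := (ρ Z3Aux.T : Matrix (Fin 2) (Fin 2) S).det
  have hd3 : d ^ 3 = 1 := by
    have hT3 : Z3Aux.T ^ 3 = 1 := by decide +kernel
    simp only [d]
    rw [← Matrix.det_pow, ← Units.val_pow_eq_pow_val, ← map_pow, hT3, map_one, Units.val_one,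
      Matrix.det_one]
  have hd1 : πS d = 1 := by
    simp only [d]
    rw [Matrix.det_fin_two, map_sub, map_mul, map_mul, hρ, hρ, hρ, hρ]
    decide +kernel
  obtain ⟨c, hc⟩ := CharP.exists S
  have hcn : c ∣ 3 ^ n := (CharP.cast_eq_zero_iff S c (3 ^ n)).mp (by exact_mod_cast hn)
  let g : ℤ_[3] →+* S := (ZMod.castHom hcn S).comp (PadicInt.toZModPow n)
  let f : Z3X3 →+* S := AdjoinRoot.lift g (d ^ 2) (by
    simp only [Polynomial.eval₂_sub, Polynomial.eval₂_pow, Polynomial.eval₂_X,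
      Polynomial.eval₂_one]
    linear_combination (d ^ 3 + 1) * hd3)
  have hfx : f x = d ^ 2 := AdjoinRoot.lift_root _
  have hfπ : ∀ y : Z3X3, πS (f y) = Z3X3.toZMod y := by
    have : πS.comp f = Z3X3.toZMod := by
      apply Z3Aux.hom_eq 1 (by decide +kernel)
      change πS (f x) = Z3X3.toZMod x
      rw [hfx, hx1, map_pow, hd1, one_pow]
    intro y
    rw [← this]; rfl
  refine ⟨f, ⟨⟨?_⟩, hfπ, ?_⟩, ?_⟩
  · intro a ha
    apply Z3Aux.isUnit_of_toZMod
    rw [← hfπ]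
    exact (ha.map πS).ne_zero
  · let σ : SpecialLinearGroup (Fin 2) (ZMod 3) →* GL (Fin 2) S :=
      (Matrix.GeneralLinearGroup.map f).comp ρ₀
    have hσ : ∀ M, (σ M : Matrix (Fin 2) (Fin 2) S) =
        (ρ₀ M : Matrix (Fin 2) (Fin 2) Z3X3).map f := fun M => rfl
    obtain ⟨X, hX1, hX2⟩ := Z3Aux.rigid πS hker ρ σ hρ
      (fun M a b => by rw [hσ, Matrix.map_apply, hfπ]; exact hρ₀ M a b)
      (by
        rw [hσ, ← RingHom.mapMatrix_apply, ← RingHom.map_det, hdet₀, map_pow, hfx]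
        change d = _
        linear_combination (-d) * hd3)
    refine ⟨X, hX1, fun M => ?_⟩
    rw [hX2 M, Units.val_mul, Units.val_mul, hσ]
  · rintro f' ⟨-, -, X, -, hX⟩
    apply Z3Aux.hom_eq n hn
    change f' x = f x
    have h1 := congrArg Matrix.det (hX Z3Aux.T)
    rw [Matrix.det_mul, Matrix.det_mul, mul_right_comm, ← Matrix.det_mul, ← Units.val_mul,
      mul_inv_cancel, Units.val_one, Matrix.det_one, one_mul, ← RingHom.mapMatrix_apply,
      ← RingHom.map_det, hdet₀] at h1
    change d = _ at h1
    rw [hfx, h1, ← map_pow]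
    congr 1
    linear_combination (-x) * hx3
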